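/- Let p be an odd prime with p ≡ 2 (mod 3). In the polynomial ring ℤ[x], the coefficient of x^{p−1} in (x²−1)^{(p−2)/3} · (x²+1)^{(2p−1)/3} is 0, and the coefficient of x^{p−1} in (x²−1)^{(2p−1)/3} · (x²+1)^{(p−2)/3} is also 0. -/

import Mathlib

open Polynomial

theorem reflect_pow_of_natDegree_le {R : Type*} [Semiring R] {f : R[X]} {d : ℕ}
    (hf : f.natDegree ≤ d) (n : ℕ) : reflect (n * d) (f ^ n) = reflect d f ^ n := by
  induction n with
  | zero => simp
  | succ n ih =>
    rw [pow_succ, pow_succ, ← ih, Nat.succ_mul]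
    exact reflect_mul _ _ (natDegree_pow_le_of_le n hf) hf

theorem coeff_eq_zero_of_reflect_eq_neg {f : ℤ[X]} {n : ℕ}
    (hf : reflect (n + n) f = -f) : f.coeff n = 0 := by
  have h := congrArg (fun g => g.coeff n) hf
  simp only [coeff_reflect, coeff_neg, revAt_le (Nat.le_add_left n n),
    Nat.add_sub_cancel] at h
  omega

theorem reflect_two_X_sq_sub_one : reflect 2 (X ^ 2 - 1 : ℤ[X]) = -(X ^ 2 - 1) := by
  have h : reflect 2 (1 : ℤ[X]) = X ^ 2 := by simp
  have h' : reflect 2 (X ^ 2 : ℤ[X]) = 1 := by rw [← h, reflect_reflect]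
  rw [reflect_sub, h, h', neg_sub]

theorem reflect_two_X_sq_add_one : reflect 2 (X ^ 2 + 1 : ℤ[X]) = X ^ 2 + 1 := by
  have h : reflect 2 (1 : ℤ[X]) = X ^ 2 := by simp
  have h' : reflect 2 (X ^ 2 : ℤ[X]) = 1 := by rw [← h, reflect_reflect]
  rw [reflect_add, h, h', add_comm]

theorem coeff_X_sq_sub_one_pow_mul_X_sq_add_one_pow {a : ℕ} (ha : Odd a) (b : ℕ) :
    ((X ^ 2 - 1) ^ a * (X ^ 2 + 1) ^ b : ℤ[X]).coeff (a + b) = 0 := by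
  have h₁ : (X ^ 2 - 1 : ℤ[X]).natDegree ≤ 2 := by compute_degree
  have h₂ : (X ^ 2 + 1 : ℤ[X]).natDegree ≤ 2 := by compute_degree
  apply coeff_eq_zero_of_reflect_eq_neg
  rw [show a + b + (a + b) = a * 2 + b * 2 by ring,
    reflect_mul _ _ (natDegree_pow_le_of_le a h₁) (natDegree_pow_le_of_le b h₂),
    reflect_pow_of_natDegree_le h₁, reflect_pow_of_natDegree_le h₂,
    reflect_two_X_sq_sub_one, reflect_two_X_sq_add_one, ha.neg_pow, neg_mul]

/-- Let `p` be an odd prime with `p ≡ 2 (mod 3)`. In `ℤ[x]`, the coefficient of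
`x^(p−1)` in `(x²−1)^((p−2)/3) · (x²+1)^((2p−1)/3)` is `0`, and the coefficient of
`x^(p−1)` in `(x²−1)^((2p−1)/3) · (x²+1)^((p−2)/3)` is also `0`. -/
theorem cartier_poly_coeff_eq_zero (p : ℕ) (hp : p.Prime) (hodd : Odd p)
    (h3 : p % 3 = 2) :
    (((X ^ 2 - 1) ^ ((p - 2) / 3) * (X ^ 2 + 1) ^ ((2 * p - 1) / 3) :
        Polynomial ℤ)).coeff (p - 1) = 0 ∧
    (((X ^ 2 - 1) ^ ((2 * p - 1) / 3) * (X ^ 2 + 1) ^ ((p - 2) / 3) :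
        Polynomial ℤ)).coeff (p - 1) = 0 := by
  obtain ⟨k, rfl⟩ := hodd
  have ha : Odd ((2 * k + 1 - 2) / 3) := by rw [Nat.odd_iff]; omega
  have hb : Odd ((2 * (2 * k + 1) - 1) / 3) := by rw [Nat.odd_iff]; omega
  have hab : 2 * k + 1 - 1 = (2 * k + 1 - 2) / 3 + (2 * (2 * k + 1) - 1) / 3 := by omega
  constructor
  · rw [hab]
    exact coeff_X_sq_sub_one_pow_mul_X_sq_add_one_pow ha _
  · rw [hab.trans (add_comm _ _)]
    exact coeff_X_sq_sub_one_pow_mul_X_sq_add_one_pow hb _
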